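/- Let n ≥ 2 be an integer. There exists ς > 0 such that for every multi-index η ∈ ℕⁿ with η ≠ 0, every finite Borel measure σ on ℝⁿ with compact support, every μ ∈ L¹(σ), and every x ∈ ℝⁿ with dist(x, supp σ) ≥ 1, the partial derivative D^η of the single layer potential v[μ] satisfies |D^η v[μ](x)| ≤ ς^{|η|} · |η|! · ∫ |μ| dσ. -/

import Mathlib

open MeasureTheory Metric Filter Topology

noncomputable section

/-- The `(n-1)`-dimensional Hausdorff measure of the unit sphere of `ℝⁿ`. -/
def sphereArea (n : ℕ) : ℝ :=
  (MeasureTheory.Measure.hausdorffMeasure ((n : ℝ) - 1)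
    (Metric.sphere (0 : EuclideanSpace ℝ (Fin n)) 1)).toReal

/-- The fundamental solution of the Laplace operator in `ℝⁿ`. -/
def fundSol (n : ℕ) (ξ : EuclideanSpace ℝ (Fin n)) : ℝ :=
  if n = 2 then (1 / (2 * Real.pi)) * Real.log ‖ξ‖
  else ‖ξ‖ ^ ((2 : ℝ) - n) / (((2 : ℝ) - n) * sphereArea n)

/-- The support of a measure: the smallest closed set whose complement is null. -/
def measSupport {E : Type*} [TopologicalSpace E] [MeasurableSpace E]
    (σ : MeasureTheory.Measure E) : Set E :=
  ⋂₀ {C : Set E | IsClosed C ∧ σ Cᶜ = 0}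

/-- Partial derivative in the `i`-th coordinate direction. -/
def pderivE {n : ℕ} (i : Fin n) (f : EuclideanSpace ℝ (Fin n) → ℝ) :
    EuclideanSpace ℝ (Fin n) → ℝ :=
  fun x => fderiv ℝ f x (EuclideanSpace.single i 1)

/-- Iterated partial derivative `D^η` associated with the multi-index `η`. -/
def mderiv {n : ℕ} (η : Fin n → ℕ) (f : EuclideanSpace ℝ (Fin n) → ℝ) :
    EuclideanSpace ℝ (Fin n) → ℝ :=
  ((List.ofFn fun i : Fin n => (pderivE i)^[η i]).foldr (fun g h => g ∘ h) id) f

/-- `f` is harmonic on `U`: twice continuously differentiable on `U` with vanishing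
Laplacian on `U`. -/
def HarmonicOnSet {n : ℕ} (f : EuclideanSpace ℝ (Fin n) → ℝ)
    (U : Set (EuclideanSpace ℝ (Fin n))) : Prop :=
  ContDiffOn ℝ 2 f U ∧ ∀ x ∈ U, (∑ i : Fin n, pderivE i (pderivE i f) x) = 0

lemma isClosed_measSupport {E : Type*} [TopologicalSpace E] [MeasurableSpace E]
    (σ : Measure E) : IsClosed (measSupport σ) :=
  isClosed_sInter fun _ hC => hC.1

lemma measure_compl_measSupport {E : Type*} [TopologicalSpace E] [SecondCountableTopology E]
    [MeasurableSpace E] (σ : Measure E) : σ (measSupport σ)ᶜ = 0 := by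
  refine measure_null_of_locally_null _ fun x hx => ?_
  obtain ⟨C, ⟨hC, hC0⟩, hxC⟩ : ∃ C : Set E, (IsClosed C ∧ σ Cᶜ = 0) ∧ x ∉ C := by
    simpa [measSupport, and_assoc] using hx
  exact ⟨Cᶜ, mem_nhdsWithin_of_mem_nhds (hC.isOpen_compl.mem_nhds hxC), hC0⟩

lemma ae_mem_measSupport {E : Type*} [TopologicalSpace E] [SecondCountableTopology E]
    [MeasurableSpace E] (σ : Measure E) : ∀ᵐ y ∂σ, y ∈ measSupport σ :=
  measure_compl_measSupport σ

section

variable {n : ℕ}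

lemma pderivE_congr {f g : EuclideanSpace ℝ (Fin n) → ℝ} {U : Set (EuclideanSpace ℝ (Fin n))}
    (hU : IsOpen U) (h : Set.EqOn f g U) (i : Fin n) :
    Set.EqOn (pderivE i f) (pderivE i g) U := fun x hx => by
  have : f =ᶠ[𝓝 x] g := Filter.eventuallyEq_of_mem (hU.mem_nhds hx) h
  simp only [pderivE, this.fderiv_eq]

lemma mderiv_eq_foldr (η : Fin n → ℕ) : ∃ L : List (Fin n), L.length = ∑ i, η i ∧
    ∀ f : EuclideanSpace ℝ (Fin n) → ℝ, mderiv η f = L.foldr pderivE f := by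
  refine ⟨(List.finRange n).flatMap fun i => List.replicate (η i) i, ?_, fun f => ?_⟩
  · simp [List.length_flatMap, ← List.ofFn_eq_map, List.sum_ofFn]
  · rw [mderiv, List.ofFn_eq_map]
    induction List.finRange n with
    | nil => rfl
    | cons i l ih =>
      have iter (k : ℕ) (g : EuclideanSpace ℝ (Fin n) → ℝ) :
          (pderivE i)^[k] g = (List.replicate k i).foldr pderivE g := by
        induction k with
        | zero => rfl
        | succ k ihk => rw [Function.iterate_succ_apply', ihk, List.replicate_succ, List.foldr_cons]
      simp only [List.map_cons, List.foldr_cons, Function.comp_apply, List.flatMap_cons,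
        List.foldr_append, ih, iter]

lemma contDiffOn_pderivE {f : EuclideanSpace ℝ (Fin n) → ℝ}
    {U : Set (EuclideanSpace ℝ (Fin n))} (hU : IsOpen U) (hf : ContDiffOn ℝ (⊤ : ℕ∞) f U)
    (i : Fin n) : ContDiffOn ℝ (⊤ : ℕ∞) (pderivE i f) U :=
  (hf.fderiv_of_isOpen hU (by simp)).clm_apply contDiffOn_const

lemma contDiffOn_foldr_pderivE {f : EuclideanSpace ℝ (Fin n) → ℝ}
    {U : Set (EuclideanSpace ℝ (Fin n))} (hU : IsOpen U) (hf : ContDiffOn ℝ (⊤ : ℕ∞) f U)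
    (L : List (Fin n)) : ContDiffOn ℝ (⊤ : ℕ∞) (L.foldr pderivE f) U := by
  induction L with
  | nil => exact hf
  | cons i L ih => exact contDiffOn_pderivE hU ih i

/-- Differentiation under the integral sign, off the support of the measure, for a kernel that
is smooth off the origin. -/
lemma pderivE_integral_kernel {f : EuclideanSpace ℝ (Fin n) → ℝ}
    (hf : ContDiffOn ℝ (⊤ : ℕ∞) f {0}ᶜ) {σ : Measure (EuclideanSpace ℝ (Fin n))}
    (hσ : IsCompact (measSupport σ)) {μ : EuclideanSpace ℝ (Fin n) → ℝ} (hμ : Integrable μ σ)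
    (i : Fin n) : Set.EqOn (pderivE i fun z => ∫ y, f (z - y) * μ y ∂σ)
      (fun z => ∫ y, pderivE i f (z - y) * μ y ∂σ) (measSupport σ)ᶜ := by
  intro x hx
  have hopen : IsOpen ({0}ᶜ : Set (EuclideanSpace ℝ (Fin n))) := isOpen_compl_singleton
  have hf' : ContinuousOn (fderiv ℝ f) {0}ᶜ := hf.continuousOn_fderiv_of_isOpen hopen (by simp)
  obtain ⟨ε, hε, hball⟩ := Metric.nhds_basis_closedBall.mem_iff.1
    ((isClosed_measSupport σ).isOpen_compl.mem_nhds hx)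
  have hne {z y : EuclideanSpace ℝ (Fin n)} (hz : z ∈ closedBall x ε) (hy : y ∈ measSupport σ) :
      z - y ∈ ({0}ᶜ : Set (EuclideanSpace ℝ (Fin n))) := by
    intro h
    rw [Set.mem_singleton_iff, sub_eq_zero] at h
    exact hball hz (h ▸ hy)
  have hmeas {F : Type} [NormedAddCommGroup F] [SecondCountableTopology F]
      {g : EuclideanSpace ℝ (Fin n) → F}
      (hg : ContinuousOn g {0}ᶜ) {z : EuclideanSpace ℝ (Fin n)} (hz : z ∈ closedBall x ε) :
      AEStronglyMeasurable (fun y => g (z - y)) σ := by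
    rw [← Measure.restrict_eq_self_of_ae_mem (ae_mem_measSupport σ)]
    refine ContinuousOn.aestronglyMeasurable ?_ (isClosed_measSupport σ).measurableSet
    exact hg.comp (by fun_prop) fun y hy => hne hz hy
  have hcpt : IsCompact ((fun p : _ × _ => p.1 - p.2) '' closedBall x ε ×ˢ measSupport σ) :=
    ((isCompact_closedBall x ε).prod hσ).image (by fun_prop)
  have hsub : (fun p : _ × _ => p.1 - p.2) '' closedBall x ε ×ˢ measSupport σ ⊆ {0}ᶜ := by
    rintro _ ⟨p, hp, rfl⟩
    exact hne hp.1 hp.2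
  obtain ⟨M, hM⟩ := hcpt.exists_bound_of_continuousOn (hf.continuousOn.mono hsub)
  obtain ⟨M', hM'⟩ := hcpt.exists_bound_of_continuousOn (hf'.mono hsub)
  have hxm : x ∈ closedBall x ε := mem_closedBall_self hε.le
  have hint : Integrable (fun y => f (x - y) * μ y) σ := by
    refine hμ.bdd_mul (c := M) (hmeas hf.continuousOn hxm) ?_
    filter_upwards [ae_mem_measSupport σ] with y hy using
      hM _ (Set.mem_image_of_mem _ (Set.mk_mem_prod hxm hy))
  have hint' : Integrable (fun y => μ y • fderiv ℝ f (x - y)) σ := by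
    refine hμ.smul_bdd M' (hmeas hf' hxm) ?_
    filter_upwards [ae_mem_measSupport σ] with y hy using
      hM' _ (Set.mem_image_of_mem _ (Set.mk_mem_prod hxm hy))
  have key := hasFDerivAt_integral_of_dominated_of_fderiv_le (𝕜 := ℝ) (μ := σ)
    (F := fun z y => f (z - y) * μ y) (F' := fun z y => μ y • fderiv ℝ f (z - y))
    (x₀ := x) (s := closedBall x ε) (bound := fun y => ‖μ y‖ * M')
    (closedBall_mem_nhds x hε)
    (Filter.eventually_of_mem (closedBall_mem_nhds x hε) fun z hz =>
      (hmeas hf.continuousOn hz).mul hμ.aestronglyMeasurable)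
    hint hint'.aestronglyMeasurable
    (by
      filter_upwards [ae_mem_measSupport σ] with y hy z hz
      rw [norm_smul]
      exact mul_le_mul_of_nonneg_left (hM' _ (Set.mem_image_of_mem _ (Set.mk_mem_prod hz hy)))
        (norm_nonneg _))
    (hμ.norm.mul_const _)
    (by
      filter_upwards [ae_mem_measSupport σ] with y hy z hz
      have hd : HasFDerivAt f (fderiv ℝ f (z - y)) (z - y) :=
        ((hf.contDiffAt (hopen.mem_nhds (hne hz hy))).differentiableAt (by simp)).hasFDerivAt
      exact (hd.comp z ((hasFDerivAt_id z).sub_const y)).mul_const (μ y))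
  simp only [pderivE]
  rw [key.fderiv, ContinuousLinearMap.integral_apply hint']
  simp [mul_comm]

lemma foldr_pderivE_integral_kernel {f : EuclideanSpace ℝ (Fin n) → ℝ}
    (hf : ContDiffOn ℝ (⊤ : ℕ∞) f {0}ᶜ) {σ : Measure (EuclideanSpace ℝ (Fin n))}
    (hσ : IsCompact (measSupport σ)) {μ : EuclideanSpace ℝ (Fin n) → ℝ} (hμ : Integrable μ σ)
    (L : List (Fin n)) : Set.EqOn (L.foldr pderivE fun z => ∫ y, f (z - y) * μ y ∂σ)
      (fun z => ∫ y, L.foldr pderivE f (z - y) * μ y ∂σ) (measSupport σ)ᶜ := by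
  induction L with
  | nil => exact fun _ _ => rfl
  | cons i L ih =>
    exact (pderivE_congr (isClosed_measSupport σ).isOpen_compl ih i).trans
      (pderivE_integral_kernel (contDiffOn_foldr_pderivE isOpen_compl_singleton hf L) hσ hμ i)

/-- Linear combinations of products of at most `d` coordinates of `ξ / ‖ξ‖` with `‖ξ‖⁻ᵃ`, whose
coefficients have absolute values adding up to at most `K`, as functions on `ℝⁿ ∖ {0}`. -/
inductive AngularSum : ℕ → ℕ → ℝ → (EuclideanSpace ℝ (Fin n) → ℝ) → Prop
  | invNormPow (a : ℕ) : AngularSum 0 a 1 fun ξ => ‖ξ‖⁻¹ ^ a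
  | coordMul {d a : ℕ} {K : ℝ} {f : EuclideanSpace ℝ (Fin n) → ℝ} (j : Fin n) :
      AngularSum d a K f → AngularSum (d + 1) a K fun ξ => ξ j * ‖ξ‖⁻¹ * f ξ
  | add {d a : ℕ} {K K' : ℝ} {f g : EuclideanSpace ℝ (Fin n) → ℝ} :
      AngularSum d a K f → AngularSum d a K' g → AngularSum d a (K + K') fun ξ => f ξ + g ξ
  | constMul {d a : ℕ} {K : ℝ} {f : EuclideanSpace ℝ (Fin n) → ℝ} (c : ℝ) :
      AngularSum d a K f → AngularSum d a (|c| * K) fun ξ => c * f ξ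
  | weaken {d d' a : ℕ} {K K' : ℝ} {f g : EuclideanSpace ℝ (Fin n) → ℝ} :
      d ≤ d' → K ≤ K' → Set.EqOn g f {0}ᶜ → AngularSum d a K f → AngularSum d' a K' g

lemma hasFDerivAt_inv_norm {E : Type*} [NormedAddCommGroup E] [InnerProductSpace ℝ E] {ξ : E}
    (hξ : ξ ≠ 0) : HasFDerivAt (fun ξ : E => ‖ξ‖⁻¹) (-(‖ξ‖⁻¹ ^ 3) • innerSL ℝ ξ) ξ := by
  have h0 : ‖ξ‖ ≠ 0 := norm_ne_zero_iff.2 hξ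
  have h1 : HasFDerivAt (fun ξ : E => ‖ξ‖) (‖ξ‖⁻¹ • innerSL ℝ ξ) ξ := by
    have := ((hasStrictFDerivAt_norm_sq ξ).hasFDerivAt).sqrt (pow_ne_zero 2 h0)
    simp only [Real.sqrt_sq (norm_nonneg _)] at this
    convert this using 1
    rw [smul_comm, ← Nat.cast_smul_eq_nsmul ℝ, smul_smul]
    congr 1
    push_cast
    field_simp
  refine ((hasDerivAt_inv h0).comp_hasFDerivAt ξ h1).congr_fderiv ?_
  rw [smul_smul]
  congr 1
  field_simp

namespace AngularSum

variable {d a : ℕ} {K : ℝ} {f : EuclideanSpace ℝ (Fin n) → ℝ}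

lemma nonneg (h : AngularSum d a K f) : 0 ≤ K := by
  induction h with
  | invNormPow => exact zero_le_one
  | coordMul _ _ ih => exact ih
  | add _ _ ih ih' => exact add_nonneg ih ih'
  | constMul c _ ih => exact mul_nonneg (abs_nonneg c) ih
  | weaken _ hK _ _ ih => exact ih.trans hK

lemma abs_le (h : AngularSum d a K f) {ξ : EuclideanSpace ℝ (Fin n)} (hξ : 1 ≤ ‖ξ‖) :
    |f ξ| ≤ K := by
  induction h with
  | invNormPow a =>
    rw [abs_of_nonneg (by positivity)]
    exact pow_le_one₀ (by positivity) (inv_le_one_of_one_le₀ hξ)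
  | @coordMul d a K f j h ih =>
    have h1 : |ξ j * ‖ξ‖⁻¹| ≤ 1 := by
      rw [abs_mul, abs_inv, abs_norm]
      exact mul_inv_le_one_of_le₀ (PiLp.norm_apply_le ξ j) (norm_nonneg _)
    rw [abs_mul]
    exact (mul_le_of_le_one_left (abs_nonneg _) h1).trans ih
  | add _ _ ih ih' => exact (abs_add_le _ _).trans (add_le_add ih ih')
  | constMul c _ ih =>
    rw [abs_mul]
    exact mul_le_mul_of_nonneg_left ih (abs_nonneg c)
  | weaken _ hK hfg _ ih =>
    rw [hfg (norm_pos_iff.1 (one_pos.trans_le hξ))]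
    exact ih.trans hK

lemma differentiableAt (h : AngularSum d a K f) {ξ : EuclideanSpace ℝ (Fin n)} (hξ : ξ ≠ 0) :
    DifferentiableAt ℝ f ξ := by
  have hN := (hasFDerivAt_inv_norm hξ).differentiableAt
  induction h with
  | invNormPow a => exact hN.pow a
  | coordMul j _ ih => exact (DifferentiableAt.mul (by fun_prop) hN).mul ih
  | add _ _ ih ih' => exact ih.add ih'
  | constMul c _ ih => exact ih.const_mul c
  | weaken _ _ hfg _ ih =>
    exact ih.congr_of_eventuallyEq
      (Filter.eventuallyEq_of_mem (isOpen_compl_singleton.mem_nhds hξ) hfg)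

lemma mul_inv_norm (h : AngularSum d a K f) : AngularSum d (a + 1) K fun ξ => f ξ * ‖ξ‖⁻¹ := by
  induction h with
  | invNormPow a => exact (invNormPow (a + 1)).weaken le_rfl le_rfl fun ξ _ => (pow_succ _ _).symm
  | coordMul j _ ih => exact (ih.coordMul j).weaken le_rfl le_rfl fun ξ _ => mul_assoc _ _ _
  | add _ _ ih ih' => exact (ih.add ih').weaken le_rfl le_rfl fun ξ _ => add_mul _ _ _
  | constMul c _ ih => exact (ih.constMul c).weaken le_rfl le_rfl fun ξ _ => mul_assoc _ _ _
  | weaken hd hK hfg _ ih =>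
    exact ih.weaken hd hK fun ξ hξ => congrArg (· * ‖ξ‖⁻¹) (hfg hξ)

lemma pderivE (h : AngularSum d a K f) (i : Fin n) :
    AngularSum (d + 1) (a + 1) ((2 * d + a) * K) (pderivE i f) := by
  induction h with
  | invNormPow a =>
    refine (((invNormPow (a + 1)).coordMul i).constMul (-a)).weaken le_rfl (by simp) ?_
    intro ξ hξ
    have hd := (hasFDerivAt_inv_norm hξ).pow a
    simp only [_root_.pderivE, hd.fderiv]
    rcases a with _ | a
    · simp
    · simp [EuclideanSpace.inner_single_right]
      ring
  | @coordMul d a K f j h ih =>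
    have h1 : AngularSum (d + 1 + 1) (a + 1) K
        fun ξ => (if i = j then 1 else 0) * (f ξ * ‖ξ‖⁻¹) :=
      (h.mul_inv_norm.constMul (if i = j then 1 else 0)).weaken (by omega)
        (by split_ifs <;> simp [h.nonneg]) fun _ _ => rfl
    have h2 := ((h.mul_inv_norm.coordMul i).coordMul j).constMul (-1)
    refine ((h1.add h2).add (ih.coordMul j)).weaken le_rfl (by push_cast; simp; linarith) ?_
    intro ξ hξ
    have hN := hasFDerivAt_inv_norm hξ
    have hj : HasFDerivAt (fun ξ : EuclideanSpace ℝ (Fin n) => ξ j)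
      (EuclideanSpace.proj j : EuclideanSpace ℝ (Fin n) →L[ℝ] ℝ) ξ :=
      (EuclideanSpace.proj j : EuclideanSpace ℝ (Fin n) →L[ℝ] ℝ).hasFDerivAt
    have hd := (hj.mul hN).mul (h.differentiableAt hξ).hasFDerivAt
    simp only [_root_.pderivE]
    erw [hd.fderiv]
    simp [EuclideanSpace.inner_single_right, eq_comm (a := i)]
    split_ifs <;> ring
  | add h h' ih ih' =>
    refine (ih.add ih').weaken le_rfl (by linarith) fun ξ hξ => ?_
    simp only [_root_.pderivE]
    erw [fderiv_add (h.differentiableAt hξ) (h'.differentiableAt hξ)]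
    rfl
  | constMul c h ih =>
    refine (ih.constMul c).weaken le_rfl (by linarith) fun ξ hξ => ?_
    simp only [_root_.pderivE]
    erw [fderiv_const_mul (h.differentiableAt hξ)]
    rfl
  | @weaken d d' a K K' f g hd hK hfg h ih =>
    refine ih.weaken (by omega) ?_ (pderivE_congr isOpen_compl_singleton hfg i)
    have := h.nonneg
    gcongr

end AngularSum

lemma contDiffOn_fundSol (n : ℕ) : ContDiffOn ℝ (⊤ : ℕ∞) (fundSol n) {0}ᶜ := by
  intro ξ hξ
  refine ContDiffAt.contDiffWithinAt ?_
  have h0 : ‖ξ‖ ≠ 0 := norm_ne_zero_iff.2 hξ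
  have hN : ContDiffAt ℝ (⊤ : ℕ∞) (fun ξ : EuclideanSpace ℝ (Fin n) => ‖ξ‖) ξ :=
    contDiffAt_norm ℝ hξ
  by_cases hn : n = 2
  · have : fundSol n = fun ξ => (1 / (2 * Real.pi)) * Real.log ‖ξ‖ := by
      ext; simp only [fundSol, if_pos hn]
    rw [this]
    exact contDiffAt_const.mul (hN.log h0)
  · have : fundSol n = fun ξ => ‖ξ‖ ^ ((2 : ℝ) - n) / (((2 : ℝ) - n) * sphereArea n) := by
      ext; simp only [fundSol, if_neg hn]
    rw [this]
    exact (hN.rpow_const_of_ne h0).div_const _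

lemma angularSum_pderivE_fundSol (hn : 2 ≤ n) : ∃ C : ℝ, ∀ i : Fin n,
    AngularSum 1 (n - 1) C (pderivE i (fundSol n)) := by
  by_cases h2 : n = 2
  · subst h2
    refine ⟨_, fun i => (((AngularSum.invNormPow 1).coordMul i).constMul
      (1 / (2 * Real.pi))).weaken le_rfl le_rfl fun ξ hξ => ?_⟩
    have h0 : ‖ξ‖ ≠ 0 := norm_ne_zero_iff.2 hξ
    have hS : fundSol 2 = fun ξ => (1 / (2 * Real.pi)) * -Real.log ‖ξ‖⁻¹ := by
      ext; simp only [fundSol, if_pos, Real.log_inv, neg_neg]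
    have hd := (((hasFDerivAt_inv_norm hξ).log (inv_ne_zero h0)).neg).const_mul
      (1 / (2 * Real.pi))
    rw [hS, pderivE]
    erw [hd.fderiv]
    simp [EuclideanSpace.inner_single_right]
    field_simp
  · obtain ⟨m, rfl⟩ : ∃ m, n = m + 2 := ⟨n - 2, by omega⟩
    have h := (AngularSum.invNormPow (n := m + 2) m).constMul
      ((((2 : ℝ) - (m + 2 : ℕ)) * sphereArea (m + 2))⁻¹)
    refine ⟨_, fun i => AngularSum.pderivE (h.weaken le_rfl le_rfl fun ξ hξ => ?_) i⟩
    rw [fundSol, if_neg h2, div_eq_inv_mul, inv_pow, ← Real.rpow_natCast,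
      ← Real.rpow_neg (norm_nonneg _)]
    congr 2
    push_cast
    ring

lemma angularSum_foldr_pderivE_fundSol {C : ℝ}
    (hC : ∀ i : Fin n, AngularSum 1 (n - 1) C (pderivE i (fundSol n))) (hn : 2 ≤ n)
    (L : List (Fin n)) (i : Fin n) : AngularSum (L.length + 1) (n - 1 + L.length)
      (C * ((n + 3) ^ L.length * L.length.factorial))
      ((L ++ [i]).foldr pderivE (fundSol n)) := by
  induction L with
  | nil => simpa using hC i
  | cons j L ih =>
    have hC0 : 0 ≤ C := (hC i).nonneg
    refine (ih.pderivE j).weaken le_rfl ?_ fun _ _ => rfl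
    simp only [List.length_cons, Nat.factorial_succ]
    obtain ⟨m, rfl⟩ : ∃ m, n = m + 1 := ⟨n - 1, by omega⟩
    push_cast [Nat.add_sub_cancel]
    have h : 2 * ((L.length : ℝ) + 1) + (m + L.length) ≤ (m + 1 + 3) * (L.length + 1) := by
      nlinarith [mul_nonneg (Nat.cast_nonneg (α := ℝ) m) (Nat.cast_nonneg (α := ℝ) L.length)]
    calc _ ≤ ((m : ℝ) + 1 + 3) * (L.length + 1) *
          (C * ((m + 1 + 3) ^ L.length * L.length.factorial)) :=
          mul_le_mul_of_nonneg_right h (by positivity)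
      _ = _ := by ring

end

/-- uniform bounds on all partial derivatives of the single layer potential
at points whose distance from the support of the measure is at least one. -/
theorem singleLayer_deriv_bound
    (n : ℕ) (hn : 2 ≤ n) :
    ∃ ς : ℝ, 0 < ς ∧
      ∀ η : Fin n → ℕ, η ≠ 0 →
      ∀ σ : Measure (EuclideanSpace ℝ (Fin n)), IsFiniteMeasure σ →
        IsCompact (measSupport σ) →
      ∀ μ : EuclideanSpace ℝ (Fin n) → ℝ, Integrable μ σ →
      ∀ x : EuclideanSpace ℝ (Fin n), 1 ≤ Metric.infDist x (measSupport σ) →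
        |mderiv η (fun z => ∫ y, fundSol n (z - y) * μ y ∂σ) x| ≤
          ς ^ (∑ i, η i) * (Nat.factorial (∑ i, η i) : ℝ) * ∫ y, |μ y| ∂σ := by
  obtain ⟨C, hC⟩ := angularSum_pderivE_fundSol hn
  have hC0 : 0 ≤ C := (hC ⟨0, by omega⟩).nonneg
  refine ⟨(n + 3) * (C + 1), by positivity, fun η hη σ _ hσ μ hμ x hx => ?_⟩
  obtain ⟨L, hL, hmderiv⟩ := mderiv_eq_foldr η
  have hne : L ≠ [] := by
    rintro rfl
    refine hη (funext fun i => ?_)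
    exact (Finset.sum_eq_zero_iff.1 hL.symm) i (Finset.mem_univ i)
  have hxs : x ∉ measSupport σ := fun h => by
    rw [Metric.infDist_zero_of_mem h] at hx
    linarith
  rw [hmderiv, ← hL, foldr_pderivE_integral_kernel (contDiffOn_fundSol n) hσ hμ L hxs]
  obtain ⟨L', i, rfl⟩ : ∃ L' i, L = L' ++ [i] :=
    ⟨_, _, (List.dropLast_append_getLast hne).symm⟩
  have hS := angularSum_foldr_pderivE_fundSol hC hn L' i
  have hK : C * ((n + 3) ^ L'.length * L'.length.factorial) ≤
      ((n + 3) * (C + 1)) ^ (L' ++ [i]).length * (L' ++ [i]).length.factorial := by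
    have h1 : C ≤ (C + 1) ^ (L'.length + 1) :=
      (le_add_of_nonneg_right zero_le_one).trans
        (le_self_pow₀ (le_add_of_nonneg_left hC0) (Nat.succ_ne_zero _))
    have h2 : ((n : ℝ) + 3) ^ L'.length ≤ (n + 3) ^ (L'.length + 1) :=
      pow_le_pow_right₀ (by linarith [Nat.cast_nonneg (α := ℝ) n]) (Nat.le_succ _)
    have h3 : (L'.length.factorial : ℝ) ≤ (L'.length + 1).factorial :=
      Nat.cast_le.2 (Nat.factorial_le (Nat.le_succ _))
    rw [List.length_append, List.length_singleton, mul_pow]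
    calc _ ≤ (C + 1) ^ (L'.length + 1) *
          (((n : ℝ) + 3) ^ (L'.length + 1) * (L'.length + 1).factorial) := by gcongr
      _ = _ := by ring
  rw [← integral_const_mul, ← Real.norm_eq_abs]
  refine norm_integral_le_of_norm_le (hμ.abs.const_mul _) ?_
  filter_upwards [ae_mem_measSupport σ] with y hy
  rw [norm_mul, Real.norm_eq_abs, Real.norm_eq_abs]
  refine mul_le_mul_of_nonneg_right ((hS.abs_le ?_).trans hK) (abs_nonneg _)
  rw [← dist_eq_norm]
  exact hx.trans (Metric.infDist_le_dist_of_mem hy)
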